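/- Define f₈ := Σ_{k≥1} χ_{(2^{−k} − 2^{−2k−1}, 2^{−k})} (the intervals being pairwise disjoint). Then 0 is a Lebesgue point of f₈, yet the Hardy–Littlewood maximal function Mf₈ is discontinuous at 0. -/

import Mathlib

open MeasureTheory Filter Set Topology
open scoped Classical

/-- The average of `f` over the interval of radius `r` centered at `x`. -/
noncomputable def avgFn (f : ℝ → ℝ) (x r : ℝ) : ℝ :=
  (1 / (2 * r)) * ∫ y in (-r)..r, f (x + y)

/-- The (uncentered-in-value, centered-in-interval) Hardy–Littlewood maximal function,
taking values in `[0,∞]`. -/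
noncomputable def maxFn (f : ℝ → ℝ) (x : ℝ) : ENNReal :=
  ⨆ (r : ℝ) (_ : 0 < r), ENNReal.ofReal (avgFn (fun y => |f y|) x r)

/-- The set `E_{f,x}` of radii attaining the maximal value. -/
def freqSet (f : ℝ → ℝ) (x : ℝ) : Set ℝ :=
  {r : ℝ | 0 < r ∧ maxFn f x = ENNReal.ofReal (avgFn (fun y => |f y|) x r)}

/-- The frequency function `Tf`. -/
noncomputable def freqFn (f : ℝ → ℝ) (x : ℝ) : ℝ :=
  if (freqSet f x).Nonempty then sInf (freqSet f x) else 0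

/-- `x` is a Lebesgue point of `f`. -/
def IsLebesguePoint (f : ℝ → ℝ) (x : ℝ) : Prop :=
  ∃ c : ℝ, Tendsto (fun r : ℝ => (1 / (2 * r)) * ∫ t in (-r)..r, |f (x + t) - c|)
    (nhdsWithin 0 (Set.Ioi 0)) (nhds 0)

/-- The function `f₈ = Σ_{k≥1} χ_{(2^{−k} − 2^{−2k−1}, 2^{−k})}`. -/
noncomputable def fEight : ℝ → ℝ := fun x =>
  ∑' k : ℕ, Set.indicator
    (Set.Ioo ((2:ℝ) ^ (-(k : ℤ) - 1) - (2:ℝ) ^ (-2 * (k : ℤ) - 3)) ((2:ℝ) ^ (-(k : ℤ) - 1)))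
    (fun _ => (1 : ℝ)) x

noncomputable def aSeq (k : ℕ) : ℝ := (1 / 2) ^ (k + 1)

def iSeq (k : ℕ) : Set ℝ := Set.Ioo (aSeq k - aSeq k ^ 2 / 2) (aSeq k)

lemma iSeq_meas (k : ℕ) : MeasurableSet (iSeq k) := measurableSet_Ioo

lemma aSeq_pos (k : ℕ) : 0 < aSeq k := by unfold aSeq; positivity

lemma aSeq_le (k : ℕ) : aSeq k ≤ 1 / 2 := by
  unfold aSeq
  rw [pow_succ]
  have : ((1:ℝ) / 2) ^ k ≤ 1 := pow_le_one₀ (by norm_num) (by norm_num)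
  linarith

lemma aSeq_lt {j k : ℕ} (h : j < k) : aSeq k ≤ aSeq j / 2 := by
  have h1 : aSeq k ≤ (1 / 2) ^ (j + 1 + 1) :=
    pow_le_pow_of_le_one (by norm_num) (by norm_num) (by omega)
  rw [pow_succ] at h1
  unfold aSeq at *
  linarith

lemma iSeq_low {k : ℕ} {x : ℝ} (h : x ∈ iSeq k) : aSeq k / 2 < x := by
  have h1 := h.1
  have := aSeq_pos k
  have := aSeq_le k
  nlinarith

lemma iSeq_unique {j k : ℕ} {x : ℝ} (hj : x ∈ iSeq j) (hk : x ∈ iSeq k) : j = k := by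
  rcases lt_trichotomy j k with h | h | h
  · have := aSeq_lt h
    have := iSeq_low hj
    have := hk.2
    linarith
  · exact h
  · have := aSeq_lt h
    have := iSeq_low hk
    have := hj.2
    linarith

lemma fEight_eq_tsum (x : ℝ) :
    fEight x = ∑' k : ℕ, (iSeq k).indicator (fun _ => (1:ℝ)) x := by
  unfold fEight
  congr 1
  ext k
  have h1 : (2:ℝ) ^ (-(k : ℤ) - 1) = aSeq k := by
    unfold aSeq
    rw [show -(k : ℤ) - 1 = -((k + 1 : ℕ) : ℤ) by push_cast; ring, zpow_neg, zpow_natCast]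
    simp
  have h2 : (2:ℝ) ^ (-2 * (k : ℤ) - 3) = aSeq k ^ 2 / 2 := by
    rw [← h1, show -2 * (k : ℤ) - 3 = (-(k : ℤ) - 1) + (-(k : ℤ) - 1) + (-1) by ring,
      zpow_add₀ (by norm_num), zpow_add₀ (by norm_num)]
    norm_num
    ring
  rw [h1, h2]
  rfl

lemma fEight_eq : fEight = (⋃ k, iSeq k).indicator (fun _ => (1:ℝ)) := by
  ext x
  rw [fEight_eq_tsum]
  by_cases h : x ∈ ⋃ k, iSeq k
  · obtain ⟨k, hk⟩ := mem_iUnion.1 h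
    rw [indicator_of_mem h, tsum_eq_single k, indicator_of_mem hk]
    intro j hj
    exact indicator_of_notMem (fun hx => hj (iSeq_unique hx hk)) _
  · rw [indicator_of_notMem h]
    have : ∀ k, (iSeq k).indicator (fun _ => (1:ℝ)) x = 0 := fun k =>
      indicator_of_notMem (fun hx => h (mem_iUnion.2 ⟨k, hx⟩)) _
    simp [this]

lemma fEight_nonneg (x : ℝ) : 0 ≤ fEight x := by
  rw [fEight_eq]; exact indicator_nonneg (fun _ _ => zero_le_one) x

lemma fEight_le (x : ℝ) : fEight x ≤ 1 := by
  rw [fEight_eq]; exact indicator_le_self' (fun _ _ => zero_le_one) x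

lemma fEight_abs (x : ℝ) : |fEight x| = fEight x := abs_of_nonneg (fEight_nonneg x)

lemma fEight_one {k : ℕ} {x : ℝ} (h : x ∈ iSeq k) : fEight x = 1 := by
  rw [fEight_eq]; exact indicator_of_mem (mem_iUnion.2 ⟨k, h⟩) _

lemma fEight_zero {x : ℝ} (h : x ≤ 0) : fEight x = 0 := by
  rw [fEight_eq]
  refine indicator_of_notMem (fun hx => ?_) _
  obtain ⟨k, hk⟩ := mem_iUnion.1 hx
  have := iSeq_low hk
  have := aSeq_pos k
  linarith

lemma fEight_meas : Measurable fEight := by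
  rw [fEight_eq]
  exact measurable_const.indicator (MeasurableSet.iUnion fun k => measurableSet_Ioo)

lemma fEight_ii (a b : ℝ) : IntervalIntegrable fEight volume a b := by
  refine (intervalIntegrable_const (c := (1:ℝ))).mono_fun
    fEight_meas.aestronglyMeasurable (ae_of_all _ fun x => ?_)
  simp only [Real.norm_eq_abs, fEight_abs, abs_one]
  exact fEight_le x

lemma avg_le_one (x r : ℝ) (hr : 0 < r) : avgFn (fun y => |fEight y|) x r ≤ 1 := by
  unfold avgFn
  have h := intervalIntegral.norm_integral_le_of_norm_le_const (a := -r) (b := r) (C := 1)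
    (f := fun y => |fEight (x + y)|) (by
      intro y _
      simp only [Real.norm_eq_abs, abs_abs, fEight_abs]
      exact fEight_le _)
  have h2 := (le_abs_self _).trans h
  rw [abs_of_pos (by linarith : 0 < r - -r)] at h2
  rw [one_div, inv_mul_le_iff₀ (by linarith)]
  linarith

lemma avg_zero (r : ℝ) (hr : 0 < r) : avgFn (fun y => |fEight y|) 0 r ≤ 1 / 2 := by
  unfold avgFn
  simp only [fEight_abs, zero_add]
  rw [← intervalIntegral.integral_add_adjacent_intervals (fEight_ii (-r) 0) (fEight_ii 0 r)]
  have h0 : ∫ y in (-r)..0, fEight y = 0 := by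
    rw [intervalIntegral.integral_congr (g := fun _ => (0:ℝ))]
    · simp
    · intro y hy
      rw [uIcc_of_le (by linarith)] at hy
      exact fEight_zero hy.2
  have h := intervalIntegral.norm_integral_le_of_norm_le_const (a := 0) (b := r) (C := 1)
    (f := fEight) (by
      intro y _
      simp only [Real.norm_eq_abs, fEight_abs]
      exact fEight_le _)
  have h2 := (le_abs_self _).trans h
  rw [abs_of_pos (by linarith : 0 < r - 0)] at h2
  rw [one_div, inv_mul_le_iff₀ (by linarith)]
  linarith

noncomputable def mid (k : ℕ) : ℝ := aSeq k - aSeq k ^ 2 / 4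

lemma avg_mid (k : ℕ) : avgFn (fun y => |fEight y|) (mid k) (aSeq k ^ 2 / 8) = 1 := by
  unfold avgFn
  have hq := (aSeq_pos k).ne'
  have hp : 0 < aSeq k ^ 2 := by have := aSeq_pos k; positivity
  rw [intervalIntegral.integral_congr (g := fun _ => (1:ℝ))]
  · simp
    field_simp
    norm_num
  · intro y hy
    rw [uIcc_of_le (by linarith)] at hy
    simp only [fEight_abs]
    apply fEight_one (k := k)
    unfold mid
    constructor <;> linarith [hy.1, hy.2]

lemma fE_max_le (x : ℝ) : maxFn fEight x ≤ 1 := by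
  unfold maxFn
  refine iSup₂_le fun r hr => ?_
  rw [← ENNReal.ofReal_one]
  exact ENNReal.ofReal_le_ofReal (avg_le_one x r hr)

lemma fE_max_mid (k : ℕ) : (maxFn fEight (mid k)).toReal = 1 := by
  have : maxFn fEight (mid k) = 1 := by
    refine le_antisymm (fE_max_le _) ?_
    unfold maxFn
    have hp : 0 < aSeq k ^ 2 / 8 := by have := aSeq_pos k; positivity
    refine le_trans ?_ (le_iSup₂ (aSeq k ^ 2 / 8) hp)
    rw [avg_mid]; simp
  rw [this]; simp

lemma fE_max_zero : (maxFn fEight 0).toReal ≤ 1 / 2 := by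
  refine ENNReal.toReal_le_of_le_ofReal (by norm_num) ?_
  unfold maxFn
  exact iSup₂_le fun r hr => ENNReal.ofReal_le_ofReal (avg_zero r hr)

lemma aSeq_tendsto : Tendsto aSeq atTop (𝓝 0) :=
  (tendsto_pow_atTop_nhds_zero_of_lt_one (by norm_num) (by norm_num)).comp (tendsto_add_atTop_nat 1)

lemma aSeq_summable : Summable aSeq :=
  (summable_nat_add_iff 1).2 (summable_geometric_of_lt_one (by norm_num) (by norm_num))

lemma not_cont : ¬ ContinuousAt (fun y => (maxFn fEight y).toReal) 0 := by
  intro h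
  have hm : Tendsto mid atTop (𝓝 0) := by
    have := aSeq_tendsto.sub ((aSeq_tendsto.pow 2).div_const 4)
    have he : mid = fun k => aSeq k - aSeq k ^ 2 / 4 := rfl
    rw [he]
    simpa using this
  have h1 := h.tendsto.comp hm
  have h2 : ((fun y => (maxFn fEight y).toReal) ∘ mid) = fun _ => (1:ℝ) := by
    ext k; exact fE_max_mid k
  rw [h2] at h1
  have h3 := tendsto_nhds_unique h1 tendsto_const_nhds
  have := fE_max_zero
  linarith

lemma int_eq (r : ℝ) (hr : 0 < r) : ∫ t in (-r)..r, fEight t =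
    ∑' k, (volume.restrict (Ioc (-r) r)).real (iSeq k) := by
  rw [intervalIntegral.integral_of_le (by linarith)]
  have hle : ∀ k, (volume.restrict (Ioc (-r) r)).real (iSeq k) ≤ aSeq k := by
    intro k
    have hp := aSeq_pos k
    have h1 := aSeq_le k
    calc _ ≤ volume.real (iSeq k) := by
          refine ENNReal.toReal_mono ?_ (Measure.restrict_apply_le _ _)
          simp [iSeq]
      _ = aSeq k ^ 2 / 2 := by
          unfold iSeq
          rw [Real.volume_real_Ioo_of_le (by nlinarith)]; ring
      _ ≤ _ := by nlinarith
  have hi : ∀ k, ∫ t in Ioc (-r) r, (iSeq k).indicator (fun _ => (1:ℝ)) t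
      = (volume.restrict (Ioc (-r) r)).real (iSeq k) := by
    intro k
    rw [integral_indicator_const _ (iSeq_meas k)]; simp
  have := integral_tsum_of_summable_integral_norm (μ := volume.restrict (Ioc (-r) r))
    (F := fun k t => (iSeq k).indicator (fun _ => (1:ℝ)) t) ?_ ?_
  · simp_rw [hi, ← fEight_eq_tsum] at this
    exact this.symm
  · intro k
    exact (integrable_const (1:ℝ)).indicator measurableSet_Ioo
  · have hn : ∀ k t, ‖(iSeq k).indicator (fun _ => (1:ℝ)) t‖
        = (iSeq k).indicator (fun _ => (1:ℝ)) t := fun k t =>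
      Real.norm_of_nonneg (indicator_nonneg (fun _ _ => zero_le_one) t)
    simp_rw [hn, hi]
    exact aSeq_summable.of_nonneg_of_le (fun k => measureReal_nonneg) hle

lemma meas_zero (r : ℝ) (k : ℕ) (h : r ≤ aSeq k / 2) :
    (volume.restrict (Ioc (-r) r)).real (iSeq k) = 0 := by
  rw [measureReal_restrict_apply (iSeq_meas k)]
  have : iSeq k ∩ Ioc (-r) r = ∅ := by
    ext x
    simp only [mem_inter_iff, mem_empty_iff_false, iff_false]
    rintro ⟨h1, h2⟩
    have := iSeq_low h1
    linarith [h2.2]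
  rw [this]; simp

lemma meas_le (r : ℝ) (k : ℕ) :
    (volume.restrict (Ioc (-r) r)).real (iSeq k) ≤ aSeq k ^ 2 / 2 := by
  have hp := aSeq_pos k
  calc _ ≤ volume.real (iSeq k) := by
        refine ENNReal.toReal_mono ?_ (Measure.restrict_apply_le _ _)
        simp [iSeq]
    _ = aSeq k ^ 2 / 2 := by
        unfold iSeq
        rw [Real.volume_real_Ioo_of_le (by nlinarith)]; ring

lemma leb : IsLebesguePoint fEight 0 := by
  refine ⟨0, ?_⟩
  simp only [zero_add, sub_zero, fEight_abs]
  have key : Tendsto (fun r : ℝ => ∑' k, (1 / (2 * r)) *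
      (volume.restrict (Ioc (-r) r)).real (iSeq k)) (𝓝[>] 0) (𝓝 (∑' _ : ℕ, (0:ℝ))) := by
    refine tendsto_tsum_of_dominated_convergence aSeq_summable ?_ ?_
    · intro k
      refine tendsto_const_nhds.congr' ?_
      have : ∀ᶠ r : ℝ in 𝓝[>] 0, r < aSeq k / 2 :=
        mem_nhdsWithin_of_mem_nhds (Iio_mem_nhds (half_pos (aSeq_pos k)))
      filter_upwards [this] with r hr
      rw [meas_zero r k hr.le, mul_zero]
    · filter_upwards [self_mem_nhdsWithin] with r hr k
      have hr : 0 < r := hr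
      have hp := aSeq_pos k
      rw [Real.norm_of_nonneg (mul_nonneg (by positivity) measureReal_nonneg)]
      rcases le_or_gt r (aSeq k / 2) with h | h
      · rw [meas_zero r k h, mul_zero]; exact hp.le
      · rw [one_div, inv_mul_le_iff₀ (by linarith)]
        have := meas_le r k
        nlinarith
  rw [tsum_zero] at key
  refine key.congr' ?_
  filter_upwards [self_mem_nhdsWithin] with r hr
  rw [int_eq r hr, tsum_mul_left]

theorem lebesgue_point_but_maximal_discontinuous :
    IsLebesguePoint fEight 0 ∧ ¬ ContinuousAt (fun y => (maxFn fEight y).toReal) 0 :=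
  ⟨leb, not_cont⟩
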